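/- Let p ∈ (0,2], let ω₁, ω₂ be weights on ℤ^d and ω₀ a weight on ℤ^d × ℤ^d with ω₂(j)/ω₁(k) ≤ ω₀(j,k) for all j, k. If A = (a(j,k)) satisfies Σ_{j,k} |a(j,k) ω₀(j,k)|^p < ∞, then A belongs to the Schatten class I_p from the weighted Hilbert space ℓ²_{(ω₁)}(ℤ^d) to ℓ²_{(ω₂)}(ℤ^d), and ‖A‖_{I_p} ≤ (Σ_{j,k} |a(j,k)ω₀(j,k)|^p)^{1/p}. -/

import Mathlib

open scoped ENNReal

/-- The `n`-th singular value (0-indexed) of a bounded operator between Hilbert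
spaces. -/
noncomputable def singVal {H₁ H₂ : Type*} [NormedAddCommGroup H₁]
    [InnerProductSpace ℂ H₁] [NormedAddCommGroup H₂] [InnerProductSpace ℂ H₂]
    (T : H₁ →L[ℂ] H₂) (n : ℕ) : ℝ :=
  sInf {r : ℝ | ∃ T₀ : H₁ →L[ℂ] H₂,
    Module.rank ℂ (LinearMap.range T₀.toLinearMap) ≤ (n : Cardinal) ∧ ‖T - T₀‖ = r}

/-- Singular value decomposition of an operator with finite-dimensional domain. -/
theorem exists_norm_sq_apply_eq_sum {E H : Type*} [NormedAddCommGroup E] [InnerProductSpace ℂ E]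
    [FiniteDimensional ℂ E] [NormedAddCommGroup H] [InnerProductSpace ℂ H] [CompleteSpace H]
    (S : E →L[ℂ] H) :
    ∃ (m : ℕ) (e : OrthonormalBasis (Fin m) ℂ E) (s : Fin m → ℝ),
      Antitone s ∧ (∀ i, 0 ≤ s i) ∧
        ∀ x, ‖S x‖ ^ 2 = ∑ i, s i ^ 2 * ‖inner ℂ (e i) x‖ ^ 2 := by
  have : CompleteSpace E := FiniteDimensional.complete ℂ E
  have hA : (S.adjoint ∘L S).toLinearMap.IsSymmetric := fun x y => by
    simp [ContinuousLinearMap.adjoint_inner_left, ContinuousLinearMap.adjoint_inner_right]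
  set e := hA.eigenvectorBasis rfl with he
  set l := hA.eigenvalues rfl with hl
  have key : ∀ x, ‖S x‖ ^ 2 = ∑ i, l i * ‖inner ℂ (e i) x‖ ^ 2 := fun x => by
    have h1 : inner ℂ x ((S.adjoint ∘L S) x) = ((‖S x‖ ^ 2 : ℝ) : ℂ) := by
      simp [ContinuousLinearMap.adjoint_inner_right, inner_self_eq_norm_sq_to_K]
    rw [← e.sum_inner_mul_inner] at h1
    have h2 : ∀ i, inner ℂ x (e i) * inner ℂ (e i) ((S.adjoint ∘L S) x) =
        ((l i * ‖inner ℂ (e i) x‖ ^ 2 : ℝ) : ℂ) := fun i => by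
      have h3 := hA.eigenvectorBasis_apply_self_apply rfl x i
      rw [OrthonormalBasis.repr_apply_apply, OrthonormalBasis.repr_apply_apply, ← he, ← hl] at h3
      rw [ContinuousLinearMap.coe_coe] at h3
      rw [h3, ← inner_conj_symm x (e i), mul_left_comm, Complex.conj_mul']
      push_cast
      rfl
    simp_rw [h2] at h1
    exact_mod_cast h1.symm
  have hnn : ∀ i, 0 ≤ l i := fun i => by
    have h := key (e i)
    rw [Finset.sum_eq_single i (fun j _ hj => by simp [e.inner_eq_zero hj]) (by simp)] at h
    simp only [inner_self_eq_norm_sq_to_K, e.norm_eq_one] at h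
    norm_num at h
    rw [← h]
    positivity
  refine ⟨_, e, fun i => √(l i), fun i j hij => Real.sqrt_le_sqrt (hA.eigenvalues_antitone rfl hij),
    fun i => Real.sqrt_nonneg _, fun x => ?_⟩
  simp_rw [Real.sq_sqrt (hnn _)]
  exact key x

/-- For `q ≤ 2`, the `q`-th powers of the singular values sum to at most the `q`-th powers of the
norms of the images of any orthonormal basis. -/
theorem sum_rpow_le_sum_norm_rpow {E H ι κ : Type*} [NormedAddCommGroup E] [InnerProductSpace ℂ E]
    [NormedAddCommGroup H] [InnerProductSpace ℂ H] [Fintype ι] [Fintype κ]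
    (S : E →L[ℂ] H) (e : OrthonormalBasis ι ℂ E) (s : ι → ℝ) (hs : ∀ i, 0 ≤ s i)
    (hS : ∀ x, ‖S x‖ ^ 2 = ∑ i, s i ^ 2 * ‖inner ℂ (e i) x‖ ^ 2)
    (b : OrthonormalBasis κ ℂ E) {q : ℝ} (hq0 : 0 < q) (hq2 : q ≤ 2) :
    ∑ i, s i ^ q ≤ ∑ k, ‖S (b k)‖ ^ q := by
  have hpow : ∀ t : ℝ, 0 ≤ t → (t ^ 2) ^ (q / 2) = t ^ q := fun t ht => by
    rw [← Real.rpow_natCast, ← Real.rpow_mul ht]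
    congr 1
    push_cast
    ring
  have hk : ∀ k, ∑ i, ‖inner ℂ (e i) (b k)‖ ^ 2 * s i ^ q ≤ ‖S (b k)‖ ^ q := fun k => by
    have h := (Real.concaveOn_rpow (p := q / 2) (by positivity) (by linarith)).le_map_sum
      (t := Finset.univ) (w := fun i => ‖inner ℂ (e i) (b k)‖ ^ 2) (p := fun i => s i ^ 2)
      (fun i _ => by positivity)
      (by rw [e.sum_sq_norm_inner_right, b.norm_eq_one]; norm_num)
      (fun i _ => by simp only [Set.mem_Ici]; positivity)
    simp only [smul_eq_mul] at h
    rw [← hpow _ (norm_nonneg _), hS]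
    simp_rw [mul_comm (s _ ^ 2)]
    simpa only [hpow _ (hs _)] using h
  calc ∑ i, s i ^ q = ∑ i, ∑ k, ‖inner ℂ (e i) (b k)‖ ^ 2 * s i ^ q := by
        refine Finset.sum_congr rfl fun i _ => ?_
        rw [← Finset.sum_mul, b.sum_sq_norm_inner_left, e.norm_eq_one]
        norm_num
    _ = ∑ k, ∑ i, ‖inner ℂ (e i) (b k)‖ ^ 2 * s i ^ q := Finset.sum_comm
    _ ≤ _ := Finset.sum_le_sum fun k _ => hk k

/-- Truncating the singular value decomposition after `n` terms leaves an error of norm at most the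
next singular value. -/
theorem exists_rank_le_norm_sub_le {E H : Type*} {m : ℕ} [NormedAddCommGroup E]
    [InnerProductSpace ℂ E] [NormedAddCommGroup H] [InnerProductSpace ℂ H]
    (S : E →L[ℂ] H) (e : OrthonormalBasis (Fin m) ℂ E) (s : Fin m → ℝ)
    (hs : ∀ i, 0 ≤ s i) (hanti : Antitone s)
    (hS : ∀ x, ‖S x‖ ^ 2 = ∑ i, s i ^ 2 * ‖inner ℂ (e i) x‖ ^ 2) (n : ℕ) :
    ∃ S₀ : E →L[ℂ] H, Module.rank ℂ (LinearMap.range S₀.toLinearMap) ≤ (n : Cardinal) ∧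
      ‖S - S₀‖ ≤ if h : n < m then s ⟨n, h⟩ else 0 := by
  classical
  set c : ℝ := if h : n < m then s ⟨n, h⟩ else 0 with hc
  have hc0 : 0 ≤ c := by rw [hc]; split_ifs; exacts [hs _, le_rfl]
  set t : Finset (Fin m) := Finset.univ.filter fun i => (i : ℕ) < n with ht
  have htc : t.card ≤ n := by
    have := Finset.card_le_card_of_injOn (s := t) (t := Finset.range n) (fun i : Fin m => (i : ℕ))
      (fun i hi => by simpa [ht] using hi) (fun i _ j _ h => Fin.ext h)
    simpa using this
  set U : Submodule ℂ E := Submodule.span ℂ (t.image e : Set E) with hU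
  have : FiniteDimensional ℂ U := FiniteDimensional.span_finset ℂ _
  refine ⟨S ∘L U.starProjection, ?_, ContinuousLinearMap.opNorm_le_bound _ hc0 fun x => ?_⟩
  · have h1 : LinearMap.range (S ∘L U.starProjection).toLinearMap ≤
        Submodule.span ℂ ((t.image fun i => S (e i) : Finset H) : Set H) := by
      rintro _ ⟨x, rfl⟩
      have h2 : U.map S.toLinearMap =
          Submodule.span ℂ ((t.image fun i => S (e i) : Finset H) : Set H) := by
        rw [hU, Submodule.map_span]
        simp [Set.image_image]
      rw [← h2]
      exact Submodule.mem_map_of_mem (U.starProjection_apply_mem x)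
    calc _ ≤ _ := Submodule.rank_mono h1
      _ ≤ _ := rank_span_finset_le _
      _ ≤ (n : Cardinal) := by exact_mod_cast Finset.card_image_le.trans htc
  · set y := x - U.starProjection x with hy
    have hyx : ‖y‖ ≤ ‖x‖ := by
      have h := U.norm_sq_eq_add_norm_sq_projection x
      have h2 : y = (Uᗮ).starProjection x := by
        rw [hy, Submodule.starProjection_orthogonal']; simp
      rw [h2]
      exact Submodule.norm_starProjection_apply_le _ _
    have hy0 : ∀ i ∈ t, inner ℂ (e i) y = 0 := fun i hi =>
      (U.sub_starProjection_mem_orthogonal x) _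
        (Submodule.subset_span (by simpa using ⟨i, hi, rfl⟩))
    have hxy : (S - S ∘L U.starProjection) x = S y := by simp [hy]
    rw [hxy]
    have h1 : ‖S y‖ ^ 2 ≤ (c * ‖y‖) ^ 2 := by
      rw [hS, mul_pow, ← e.sum_sq_norm_inner_right y, Finset.mul_sum]
      refine Finset.sum_le_sum fun i _ => ?_
      by_cases hi : i ∈ t
      · simp [hy0 i hi]
      · have hin : n ≤ i := by simpa [ht] using hi
        have hnm : n < m := hin.trans_lt i.2
        have : s i ≤ c := by
          rw [hc, dif_pos hnm]
          exact hanti hin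
        gcongr
        exact hs i
    exact (le_of_sq_le_sq h1 (by positivity)).trans (by gcongr)

theorem singVal_nonneg {H₁ H₂ : Type*} [NormedAddCommGroup H₁]
    [InnerProductSpace ℂ H₁] [NormedAddCommGroup H₂] [InnerProductSpace ℂ H₂]
    (T : H₁ →L[ℂ] H₂) (n : ℕ) : 0 ≤ singVal T n :=
  Real.sInf_nonneg (by rintro _ ⟨T₀, -, rfl⟩; exact norm_nonneg _)

theorem singVal_le_norm_sub {H₁ H₂ : Type*} [NormedAddCommGroup H₁]
    [InnerProductSpace ℂ H₁] [NormedAddCommGroup H₂] [InnerProductSpace ℂ H₂]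
    (T T₀ : H₁ →L[ℂ] H₂) {n : ℕ}
    (h : Module.rank ℂ (LinearMap.range T₀.toLinearMap) ≤ (n : Cardinal)) :
    singVal T n ≤ ‖T - T₀‖ :=
  csInf_le ⟨0, by rintro _ ⟨T₀, -, rfl⟩; exact norm_nonneg _⟩ ⟨T₀, h, rfl⟩

/-- Cauchy–Schwarz for a series of vectors with square-summable coefficients. -/
theorem summable_norm_smul_and_norm_tsum_le {ι H : Type*} [NormedAddCommGroup H]
    [NormedSpace ℂ H] [CompleteSpace H] {x : ι → ℂ} {c : ι → H}
    (hx : Summable fun k => ‖x k‖ ^ 2) (hc : Summable fun k => ‖c k‖ ^ 2) :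
    (Summable fun k => x k • c k) ∧
      ‖∑' k, x k • c k‖ ≤ √(∑' k, ‖x k‖ ^ 2) * √(∑' k, ‖c k‖ ^ 2) := by
  obtain ⟨h1, h2⟩ := Real.summable_and_inner_le_Lp_mul_Lq_tsum_of_nonneg
    (f := fun k => ‖x k‖) (g := fun k => ‖c k‖) (Real.HolderConjugate.two_two)
    (fun k => norm_nonneg _) (fun k => norm_nonneg _)
    (by simpa using hx) (by simpa using hc)
  have h3 : Summable fun k => ‖x k • c k‖ := by simpa only [norm_smul] using h1
  refine ⟨h3.of_norm, (norm_tsum_le_tsum_norm h3).trans ?_⟩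
  simpa only [norm_smul, Real.sqrt_eq_rpow, Real.rpow_two] using h2

/-- Approximating `T` by its restriction to the span of finitely many basis vectors. -/
theorem norm_sub_comp_starProjection_le {ι H H' : Type*} [NormedAddCommGroup H]
    [InnerProductSpace ℂ H] [CompleteSpace H] [NormedAddCommGroup H'] [InnerProductSpace ℂ H']
    [CompleteSpace H'] (b : HilbertBasis ι ℂ H) (T : H →L[ℂ] H')
    (hT : Summable fun k => ‖T (b k)‖ ^ 2) (F : Finset ι) (U : Submodule ℂ H)
    [U.HasOrthogonalProjection] (hU : ∀ k ∈ F, b k ∈ U) :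
    ‖T - T ∘L U.starProjection‖ ≤ √(∑' k : {k // k ∉ F}, ‖T (b k)‖ ^ 2) := by
  refine ContinuousLinearMap.opNorm_le_bound _ (Real.sqrt_nonneg _) fun x => ?_
  set y := x - U.starProjection x with hy
  have hyx : ‖y‖ ≤ ‖x‖ := by
    have h2 : y = (Uᗮ).starProjection x := by
      rw [hy, Submodule.starProjection_orthogonal']; simp
    rw [h2]
    exact Submodule.norm_starProjection_apply_le _ _
  have hy0 : ∀ k ∈ F, inner ℂ (b k) y = 0 := fun k hk =>
    (U.sub_starProjection_mem_orthogonal x) _ (hU k hk)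
  have hxy : (T - T ∘L U.starProjection) x = T y := by simp [hy]
  have hsum : Summable fun k => ‖inner ℂ (b k) y‖ ^ 2 := by
    have h := (b.summable_inner_mul_inner y y).norm
    refine h.congr fun k => ?_
    rw [norm_mul, norm_inner_symm, sq]
  have hnorm : ∑' k, ‖inner ℂ (b k) y‖ ^ 2 = ‖y‖ ^ 2 := by
    have h := b.tsum_inner_mul_inner y y
    have h' : ∀ k, inner ℂ y (b k) * inner ℂ (b k) y = ((‖inner ℂ (b k) y‖ ^ 2 : ℝ) : ℂ) :=
      fun k => by
        rw [← inner_conj_symm y (b k), Complex.conj_mul']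
        push_cast
        rfl
    simp_rw [h'] at h
    rw [← Complex.ofReal_tsum, inner_self_eq_norm_sq_to_K] at h
    exact Complex.ofReal_injective (h.trans (Complex.ofReal_pow _ _).symm)
  have hTy : T y = ∑' k : {k // k ∉ F}, inner ℂ (b k) y • T (b k) := by
    have h := (b.hasSum_repr y).mapL T
    simp only [map_smul, HilbertBasis.repr_apply_apply] at h
    rw [← h.tsum_eq]
    refine (tsum_subtype_eq_of_support_subset (s := {k | k ∉ F}) fun k hk hkF => hk ?_).symm
    simp [hy0 k hkF]
  have hle : ∑' k : {k // k ∉ F}, ‖inner ℂ (b k) y‖ ^ 2 ≤ ‖y‖ ^ 2 := by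
    rw [← hnorm]
    exact hsum.tsum_subtype_le _ _ (fun k => sq_nonneg _)
  rw [hxy, hTy]
  refine (summable_norm_smul_and_norm_tsum_le (hsum.subtype _) (hT.subtype _)).2.trans ?_
  rw [mul_comm]
  refine mul_le_mul_of_nonneg_left ?_ (Real.sqrt_nonneg _)
  exact (Real.sqrt_le_iff.2 ⟨norm_nonneg _, hle⟩).trans hyx

/-- Comparison of the `ℓ^q` and `ℓ²` quasi-norms for `q ≤ 2`. -/
theorem summable_sq_and_tsum_sq_rpow_le {ι : Type*} {x : ι → ℝ} (hx : ∀ i, 0 ≤ x i) {q : ℝ}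
    (hq0 : 0 < q) (hq2 : q ≤ 2) (h : Summable fun i => x i ^ q) :
    (Summable fun i => x i ^ 2) ∧ (∑' i, x i ^ 2) ^ (q / 2) ≤ ∑' i, x i ^ q := by
  set A := ∑' i, x i ^ q with hA
  have hA0 : 0 ≤ A := tsum_nonneg fun i => Real.rpow_nonneg (hx i) _
  have hxA : ∀ i, x i ≤ A ^ (1 / q) := fun i => by
    have h1 : x i ^ q ≤ A := h.le_tsum i fun j _ => Real.rpow_nonneg (hx j) _
    have h2 := Real.rpow_le_rpow (Real.rpow_nonneg (hx i) _) h1 (by positivity : 0 ≤ 1 / q)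
    rwa [← Real.rpow_mul (hx i), mul_one_div_cancel hq0.ne', Real.rpow_one] at h2
  have hle : ∀ i, x i ^ 2 ≤ x i ^ q * (A ^ (1 / q)) ^ (2 - q) := fun i => by
    have h1 : x i ^ 2 = x i ^ q * x i ^ (2 - q) := by
      rw [← Real.rpow_add_of_nonneg (hx i) hq0.le (by linarith)]
      rw [← Real.rpow_natCast]
      congr 1
      push_cast
      ring
    rw [h1]
    have := Real.rpow_nonneg (hx i) q
    gcongr
    · exact hx i
    · exact hxA i
  have hs : Summable fun i => x i ^ 2 :=
    Summable.of_nonneg_of_le (fun i => sq_nonneg _) hle (h.mul_right _)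
  refine ⟨hs, ?_⟩
  have h1 : ∑' i, x i ^ 2 ≤ A * (A ^ (1 / q)) ^ (2 - q) := by
    rw [hA, ← tsum_mul_right]
    exact hs.tsum_le_tsum hle (h.mul_right _)
  have h2 : A * (A ^ (1 / q)) ^ (2 - q) = A ^ (2 / q) := by
    rw [← Real.rpow_mul hA0]
    nth_rewrite 1 [← Real.rpow_one A]
    rw [← Real.rpow_add_of_nonneg hA0 zero_le_one
      (mul_nonneg (by positivity) (by linarith))]
    congr 1
    field_simp
    ring
  rw [h2] at h1
  refine (Real.rpow_le_rpow (tsum_nonneg fun i => sq_nonneg _) h1 (by positivity)).trans ?_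
  rw [← Real.rpow_mul hA0, div_mul_div_comm, mul_comm 2 q, div_self (by positivity), Real.rpow_one]

open Filter Topology in
/-- The Schatten quasi-norm of `T`, for exponents `q ≤ 2`, is at most the `ℓ^q` quasi-norm of the
family `‖T (b k)‖` for any Hilbert basis `b`. -/
theorem summable_singVal_rpow_and_tsum_le {ι H H' : Type*} [NormedAddCommGroup H]
    [InnerProductSpace ℂ H] [CompleteSpace H] [NormedAddCommGroup H'] [InnerProductSpace ℂ H']
    [CompleteSpace H'] (b : HilbertBasis ι ℂ H) (T : H →L[ℂ] H') {q : ℝ} (hq0 : 0 < q)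
    (hq2 : q ≤ 2) (hT : Summable fun k => ‖T (b k)‖ ^ q) :
    (Summable fun n => singVal T n ^ q) ∧ ∑' n, singVal T n ^ q ≤ ∑' k, ‖T (b k)‖ ^ q := by
  classical
  have hT2 := (summable_sq_and_tsum_sq_rpow_le (fun k => norm_nonneg (T (b k))) hq0 hq2 hT).1
  set ε : Finset ι → ℝ := fun F => √(∑' k : {k // k ∉ F}, ‖T (b k)‖ ^ 2) with hε
  have hε0 : Tendsto ε atTop (𝓝 0) := by
    have h := (tendsto_tsum_compl_atTop_zero fun k => ‖T (b k)‖ ^ 2).sqrt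
    rwa [Real.sqrt_zero] at h
  have hF : ∀ (F : Finset ι) (N : ℕ), ∑ n ∈ Finset.range N, (max 0 (singVal T n - ε F)) ^ q ≤
      ∑' k, ‖T (b k)‖ ^ q := fun F N => by
    set U : Submodule ℂ H := Submodule.span ℂ (F.image b : Set H) with hU
    have : FiniteDimensional ℂ U := FiniteDimensional.span_finset ℂ _
    let f : OrthonormalBasis F ℂ U := OrthonormalBasis.span b.orthonormal F
    have hf : ∀ k, (f k : H) = b k := OrthonormalBasis.span_apply b.orthonormal F
    obtain ⟨m, e, s, hanti, hs, hS⟩ := exists_norm_sq_apply_eq_sum (T ∘L U.subtypeL)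
    set μ : ℕ → ℝ := fun n => if h : n < m then s ⟨n, h⟩ else 0 with hμ
    have hμ0 : ∀ n, 0 ≤ μ n := fun n => by
      simp only [hμ]; split_ifs; exacts [hs _, le_rfl]
    have hle : ∀ n, singVal T n ≤ ε F + μ n := fun n => by
      obtain ⟨S₀, hr, hn⟩ := exists_rank_le_norm_sub_le _ e s hs hanti hS n
      have hr' : Module.rank ℂ (LinearMap.range (S₀ ∘L U.orthogonalProjectionOnto).toLinearMap) ≤
          (n : Cardinal) :=
        (Submodule.rank_mono (LinearMap.range_comp_le_range _ _)).trans hr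
      refine (singVal_le_norm_sub T _ hr').trans ?_
      have hdec : T - S₀ ∘L U.orthogonalProjectionOnto = (T - T ∘L U.starProjection) +
          (T ∘L U.subtypeL - S₀) ∘L U.orthogonalProjectionOnto := by
        ext x
        simp
      rw [hdec]
      have hproj := norm_sub_comp_starProjection_le b T hT2 F U fun k hk =>
        Submodule.subset_span (by simpa using ⟨k, hk, rfl⟩)
      refine (norm_add_le _ _).trans <| add_le_add hproj ?_
      refine (ContinuousLinearMap.opNorm_comp_le _ _).trans ?_
      exact (mul_le_of_le_one_right (norm_nonneg _) U.orthogonalProjectionOnto_norm_le).trans hn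
    calc ∑ n ∈ Finset.range N, (max 0 (singVal T n - ε F)) ^ q
        ≤ ∑ n ∈ Finset.range N, μ n ^ q := Finset.sum_le_sum fun n _ =>
          Real.rpow_le_rpow (le_max_left _ _)
            (max_le (hμ0 n) (by linarith [hle n])) hq0.le
      _ ≤ ∑ n ∈ Finset.range (max N m), μ n ^ q :=
          Finset.sum_le_sum_of_subset_of_nonneg
            (Finset.range_subset_range.2 (le_max_left _ _))
            fun n _ _ => Real.rpow_nonneg (hμ0 n) _
      _ = ∑ n ∈ Finset.range m, μ n ^ q := by
          refine (Finset.sum_subset (Finset.range_subset_range.2 (le_max_right _ _))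
            fun n _ hn => ?_).symm
          simp only [hμ]
          rw [dif_neg (by simpa using hn), Real.zero_rpow hq0.ne']
      _ = ∑ i, s i ^ q := by
          rw [Finset.sum_range]
          simp [hμ]
      _ ≤ ∑ k, ‖(T ∘L U.subtypeL) (f k)‖ ^ q :=
          sum_rpow_le_sum_norm_rpow _ e s hs hS f hq0 hq2
      _ = ∑ k ∈ F, ‖T (b k)‖ ^ q := by
          rw [← Finset.sum_coe_sort F]
          simp only [ContinuousLinearMap.comp_apply, Submodule.subtypeL_apply, hf]
      _ ≤ ∑' k, ‖T (b k)‖ ^ q :=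
          hT.sum_le_tsum F fun k _ => Real.rpow_nonneg (norm_nonneg _) _
  have hN : ∀ N : ℕ, ∑ n ∈ Finset.range N, singVal T n ^ q ≤ ∑' k, ‖T (b k)‖ ^ q := fun N => by
    refine le_of_tendsto' (x := atTop) (tendsto_finsetSum _ fun n _ => ?_) fun F => hF F N
    have h := ((tendsto_const_nhds (x := (0 : ℝ))).max
      ((tendsto_const_nhds (x := singVal T n)).sub hε0)).rpow_const (p := q) (Or.inr hq0.le)
    rwa [sub_zero, max_eq_right (singVal_nonneg T n)] at h
  have h0 : ∀ n, 0 ≤ singVal T n ^ q := fun n => Real.rpow_nonneg (singVal_nonneg T n) _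
  exact ⟨summable_of_sum_range_le h0 hN, Real.tsum_le_of_sum_range_le h0 hN⟩

/-- The operator on `ℓ²` with a given square-summable family of columns. -/
theorem exists_continuousLinearMap_hasSum {ι H : Type*} [NormedAddCommGroup H]
    [InnerProductSpace ℂ H] [CompleteSpace H] {c : ι → H} (hc : Summable fun k => ‖c k‖ ^ 2) :
    ∃ T : lp (fun _ : ι => ℂ) 2 →L[ℂ] H,
      ∀ f : lp (fun _ : ι => ℂ) 2, HasSum (fun k => (f : ι → ℂ) k • c k) (T f) := by
  have hf : ∀ f : lp (fun _ : ι => ℂ) 2, HasSum (fun k => ‖(f : ι → ℂ) k‖ ^ 2) (‖f‖ ^ 2) :=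
    fun f => by simpa using lp.hasSum_norm (by norm_num) f
  have hs := fun f => (summable_norm_smul_and_norm_tsum_le (hf f).summable hc).1
  let L : lp (fun _ : ι => ℂ) 2 →ₗ[ℂ] H :=
    { toFun := fun f => ∑' k, (f : ι → ℂ) k • c k
      map_add' := fun f g => by
        rw [← (hs f).tsum_add (hs g)]
        simp [add_smul]
      map_smul' := fun r f => by
        rw [RingHom.id_apply, ← (hs f).tsum_const_smul]
        simp [mul_smul] }
  refine ⟨L.mkContinuous √(∑' k, ‖c k‖ ^ 2) fun f => ?_, fun f => (hs f).hasSum⟩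
  have h := (summable_norm_smul_and_norm_tsum_le (hf f).summable hc).2
  rw [(hf f).tsum_eq, Real.sqrt_sq (norm_nonneg _)] at h
  rwa [mul_comm]

/-- For `q ≤ 2`, a matrix with `q`-summable entries defines an operator on `ℓ²` whose Schatten
quasi-norm is at most the `ℓ^q` quasi-norm of its entries. -/
theorem exists_singVal_summable_of_matrix {ι : Type*} {q : ℝ} (hq0 : 0 < q) (hq2 : q ≤ 2)
    (M : ι → ι → ℂ) (hM : Summable fun jk : ι × ι => ‖M jk.1 jk.2‖ ^ q) :
    ∃ T : lp (fun _ : ι => ℂ) 2 →L[ℂ] lp (fun _ : ι => ℂ) 2,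
      (∀ f : lp (fun _ : ι => ℂ) 2, ∀ j,
        (T f : ι → ℂ) j = ∑' k, M j k * (f : ι → ℂ) k) ∧
      Summable (fun n => singVal T n ^ q) ∧
      ∑' n, singVal T n ^ q ≤ ∑' jk : ι × ι, ‖M jk.1 jk.2‖ ^ q := by
  classical
  have hM' : Summable fun kj : ι × ι => ‖M kj.2 kj.1‖ ^ q := hM.prod_symm
  have hcol := fun k => summable_sq_and_tsum_sq_rpow_le (fun j => norm_nonneg (M j k)) hq0 hq2
    (hM'.prod_factor k)
  let c : ι → lp (fun _ : ι => ℂ) 2 := fun k =>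
    ⟨fun j => M j k, memℓp_gen (by simpa using (hcol k).1)⟩
  have hc : ∀ k, ‖c k‖ ^ q ≤ ∑' j, ‖M j k‖ ^ q := fun k => by
    have h1 : ‖c k‖ ^ 2 = ∑' j, ‖M j k‖ ^ 2 := by
      simpa using lp.norm_rpow_eq_tsum (by norm_num) (c k)
    have h2 := (hcol k).2
    rw [← h1, ← Real.rpow_natCast, ← Real.rpow_mul (norm_nonneg _)] at h2
    convert h2 using 2
    push_cast
    ring
  have hcs : Summable fun k => ‖c k‖ ^ q :=
    Summable.of_nonneg_of_le (fun k => Real.rpow_nonneg (norm_nonneg _) _) hc hM'.prod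
  obtain ⟨T, hT⟩ := exists_continuousLinearMap_hasSum
    (summable_sq_and_tsum_sq_rpow_le (fun k => norm_nonneg (c k)) hq0 hq2 hcs).1
  let b : HilbertBasis ι ℂ (lp (fun _ : ι => ℂ) 2) :=
    HilbertBasis.ofRepr (LinearIsometryEquiv.refl ℂ _)
  have hTb : ∀ k, T (b k) = c k := fun k => by
    have hb : b k = lp.single 2 k (1 : ℂ) := by
      rw [← b.repr_symm_single]
      rfl
    rw [hb]
    refine (hT _).unique ?_
    convert hasSum_single (f := fun i => (lp.single 2 k (1 : ℂ) : ι → ℂ) i • c i) k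
      (fun i hi => by rw [lp.single_apply_ne _ _ _ hi, zero_smul]) using 1
    rw [lp.single_apply_self, one_smul]
  obtain ⟨h1, h2⟩ := summable_singVal_rpow_and_tsum_le b T hq0 hq2 (by simpa only [hTb] using hcs)
  refine ⟨T, fun f j => ?_, h1, h2.trans ?_⟩
  · have h := (hT f).mapL (lp.evalCLM ℂ (fun _ : ι => ℂ) 2 j)
    refine (h.tsum_eq.symm.trans (tsum_congr fun k => ?_))
    exact mul_comm _ _
  · simp only [hTb]
    calc ∑' k, ‖c k‖ ^ q ≤ ∑' k, ∑' j, ‖M j k‖ ^ q := hcs.tsum_le_tsum hc hM'.prod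
      _ = ∑' kj : ι × ι, ‖M kj.2 kj.1‖ ^ q := hM'.tsum_prod.symm
      _ = ∑' jk : ι × ι, ‖M jk.1 jk.2‖ ^ q :=
        (Equiv.prodComm ι ι).tsum_eq fun jk : ι × ι => ‖M jk.1 jk.2‖ ^ q

/-- weighted Schatten embedding `U^p(ω₀) ⊆ I_p(ℓ²_{(ω₁)}, ℓ²_{(ω₂)})`
for `p ∈ (0,2]`, with `‖A‖_{I_p} ≤ (Σ_{j,k} |a(j,k)ω₀(j,k)|^p)^{1/p}` (stated via
`p`-th powers).  The weighted spaces `ℓ²_{(ωₗ)}` are realized through the unitary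
maps `f ↦ f·ωₗ` onto `ℓ²(ℤ^d)`; under this identification the operator `A` from
`ℓ²_{(ω₁)}` to `ℓ²_{(ω₂)}` becomes the operator `T` on `ℓ²` with matrix
`ω₂(j)·a(j,k)·ω₁(k)⁻¹`. -/
theorem stmt10 (d : ℕ) (p : ℝ) (hp0 : 0 < p) (hp2 : p ≤ 2)
    (ω₁ ω₂ : (Fin d → ℤ) → ℝ) (ω₀ : (Fin d → ℤ) → (Fin d → ℤ) → ℝ)
    (hω₁ : ∀ j, 0 < ω₁ j) (hω₂ : ∀ j, 0 < ω₂ j) (hω₀ : ∀ j k, 0 < ω₀ j k)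
    (hw : ∀ j k, ω₂ j / ω₁ k ≤ ω₀ j k)
    (a : (Fin d → ℤ) → (Fin d → ℤ) → ℂ)
    (ha : Summable (fun jk : (Fin d → ℤ) × (Fin d → ℤ) =>
      (‖a jk.1 jk.2‖ * ω₀ jk.1 jk.2) ^ p)) :
    ∃ T : lp (fun _ : Fin d → ℤ => ℂ) 2 →L[ℂ] lp (fun _ : Fin d → ℤ => ℂ) 2,
      (∀ f : lp (fun _ : Fin d → ℤ => ℂ) 2, ∀ j,
        (T f : (Fin d → ℤ) → ℂ) j =
          ∑' k, (ω₂ j : ℂ) * a j k * (ω₁ k : ℂ)⁻¹ * (f : (Fin d → ℤ) → ℂ) k) ∧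
      Summable (fun n => singVal T n ^ p) ∧
      (∑' n, singVal T n ^ p) ≤
        ∑' jk : (Fin d → ℤ) × (Fin d → ℤ), (‖a jk.1 jk.2‖ * ω₀ jk.1 jk.2) ^ p := by
  have hle : ∀ jk : (Fin d → ℤ) × (Fin d → ℤ),
      ‖(ω₂ jk.1 : ℂ) * a jk.1 jk.2 * (ω₁ jk.2 : ℂ)⁻¹‖ ^ p ≤
        (‖a jk.1 jk.2‖ * ω₀ jk.1 jk.2) ^ p := fun jk => by
    refine Real.rpow_le_rpow (norm_nonneg _) ?_ hp0.le
    rw [norm_mul, norm_mul, norm_inv, Complex.norm_of_nonneg (hω₂ _).le,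
      Complex.norm_of_nonneg (hω₁ _).le, mul_comm (ω₂ _), mul_assoc, ← div_eq_mul_inv]
    exact mul_le_mul_of_nonneg_left (hw _ _) (norm_nonneg _)
  have hs := Summable.of_nonneg_of_le (fun _ => Real.rpow_nonneg (norm_nonneg _) _) hle ha
  obtain ⟨T, hT, h1, h2⟩ := exists_singVal_summable_of_matrix hp0 hp2
    (fun j k => (ω₂ j : ℂ) * a j k * (ω₁ k : ℂ)⁻¹) hs
  exact ⟨T, hT, h1, h2.trans (hs.tsum_le_tsum hle ha)⟩
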